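/- Let σ > 0. For Δ > 0 define the family p_{σ,Δ}(x) = e^{−Δ} Σ_{k=0}^∞ (Δ^k/k!) · φ_{σ²Δ}(x − σk), with σ-derivative ∂_σ p_{σ,Δ}(x) = e^{−Δ} Σ_{k=0}^∞ (Δ^k/k!) · φ_{σ²Δ}(x − σk) · ( (x − σk)²/(σ³Δ) + k(x − σk)/(σ²Δ) − 1/σ ). Then lim_{Δ→0} ∫ (∂_σ p_{σ,Δ}(x))²/p_{σ,Δ}(x) dx = 3/σ². -/

import Mathlib

open MeasureTheory Filter Topology

/-- The centered Gaussian density with variance `v`. -/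
noncomputable def gauss (v x : ℝ) : ℝ :=
  (Real.sqrt (2 * Real.pi * v))⁻¹ * Real.exp (-(x ^ 2) / (2 * v))


noncomputable def phi (v : ℝ) : ℝ := (Real.sqrt (2 * Real.pi))⁻¹ * Real.exp (-(v ^ 2) / 2)

lemma phi_pos (v : ℝ) : 0 < phi v := by unfold phi; positivity

lemma phi_int_pow (n : ℕ) : Integrable (fun v : ℝ => phi v * v ^ n) := by
  have h := integrable_rpow_mul_exp_neg_mul_sq (b := 1/2) (by norm_num) (s := n)
    (by have : (0:ℝ) ≤ n := Nat.cast_nonneg n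
        linarith)
  refine (h.const_mul ((Real.sqrt (2 * Real.pi))⁻¹)).congr (ae_of_all _ fun v => ?_)
  simp only [Real.rpow_natCast, phi]
  rw [show -(v^2)/2 = -(1/2) * v^2 by ring]
  ring

lemma phi_deriv (v : ℝ) : HasDerivAt phi (- v * phi v) v := by
  have h1 : HasDerivAt (fun v : ℝ => -(v ^ 2) / 2) (-v) v := by
    have := ((hasDerivAt_pow 2 v).neg).div_const 2
    convert! this using 1
    simp; ring
  have := (h1.exp).const_mul ((Real.sqrt (2 * Real.pi))⁻¹)
  convert! this using 1
  unfold phi; ring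

lemma phi_integral : ∫ v, phi v = 1 := by
  have := integral_gaussian (1/2)
  unfold phi
  rw [integral_const_mul]
  have h2 : ∀ v : ℝ, -(v^2)/2 = -(1/2) * v^2 := fun v => by ring
  simp only [h2, this]
  rw [show Real.pi / (1/2) = 2 * Real.pi by ring]
  exact inv_mul_cancel₀ (by positivity)

lemma phi_int_quad (a : ℝ) : Integrable (fun v : ℝ => phi v * (v^2 - 1 + a * v)^2) := by
  have h := ((((phi_int_pow 4).add ((phi_int_pow 3).const_mul (2*a))).add
    ((phi_int_pow 2).const_mul (a^2-2))).add ((phi_int_pow 1).const_mul (-2*a))).add (phi_int_pow 0)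
  refine h.congr (ae_of_all _ fun v => ?_)
  simp only [Pi.add_apply]; ring

lemma phi_integral_quad (a : ℝ) : ∫ v, phi v * (v^2 - 1 + a * v)^2 = 2 + a^2 := by
  have h0 := phi_int_pow 0
  simp only [pow_zero, mul_one] at h0
  have key : ∫ v, (phi v * (v^2 - 1 + a * v)^2 - (2 + a^2) * phi v) = 0 := by
    apply integral_eq_zero_of_hasDerivAt_of_integrable
      (f := fun v => (-v^3 - 2*a*v^2 + (-1-a^2)*v - 2*a) * phi v)
    · intro v
      have h1 : HasDerivAt (fun v : ℝ => -v^3 - 2*a*v^2 + (-1-a^2)*v - 2*a)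
          (-(3*v^2) - 2*a*(2*v) + (-1-a^2)) v := by
        have := ((((hasDerivAt_pow 3 v).neg).sub ((hasDerivAt_pow 2 v).const_mul (2*a))).add
          ((hasDerivAt_id v).const_mul (-1-a^2))).sub_const (2*a)
        convert! this using 1
        simp
      convert! h1.mul (phi_deriv v) using 1
      ring
    · exact (phi_int_quad a).sub (h0.const_mul _)
    · have h := (((phi_int_pow 3).const_mul (-1)).add ((phi_int_pow 2).const_mul (-2*a))).add
        (((phi_int_pow 1).const_mul (-1-a^2)).add ((phi_int_pow 0).const_mul (-2*a)))
      refine h.congr (ae_of_all _ fun v => ?_)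
      simp only [Pi.add_apply]; ring
  rw [integral_sub (phi_int_quad a) (h0.const_mul _), integral_const_mul, phi_integral] at key
  linarith

lemma pois0 (d : ℝ) : HasSum (fun k : ℕ => d^k / (k.factorial : ℝ)) (Real.exp d) := by
  rw [Real.exp_eq_exp_ℝ]
  exact NormedSpace.expSeries_div_hasSum_exp d

lemma pois1 (d : ℝ) : HasSum (fun k : ℕ => d^k / (k.factorial : ℝ) * k) (d * Real.exp d) := by
  rw [← hasSum_nat_add_iff' 1]
  simp only [Finset.sum_range_one, Nat.cast_zero, mul_zero, sub_zero]
  refine ((pois0 d).mul_left d).congr_fun ?_ 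
  intro k
  have := Nat.factorial_ne_zero k
  rw [Nat.factorial_succ]; push_cast; field_simp; ring

lemma pois2 (d : ℝ) : HasSum (fun k : ℕ => d^k / (k.factorial : ℝ) * (k * (k - 1)))
    (d^2 * Real.exp d) := by
  rw [← hasSum_nat_add_iff' 1]
  simp only [Finset.sum_range_one, Nat.cast_zero, mul_zero, sub_zero, zero_mul]
  have h := (pois1 d).mul_left d
  rw [show d * (d * Real.exp d) = d^2 * Real.exp d by ring] at h
  refine h.congr_fun ?_
  intro k
  have := Nat.factorial_ne_zero k
  rw [Nat.factorial_succ]; push_cast; field_simp; ring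

/-- Poisson weight -/
noncomputable def poi (d : ℝ) (k : ℕ) : ℝ := Real.exp (-d) * (d^k / (k.factorial : ℝ))

lemma poi_nonneg {d : ℝ} (hd : 0 < d) (k : ℕ) : 0 ≤ poi d k := by unfold poi; positivity

lemma poi_sum (d a b c : ℝ) :
    HasSum (fun k : ℕ => poi d k * (a + b * k + c * (k * (k-1)))) (a + b * d + c * d^2) := by
  have h := ((((pois0 d).mul_left a).add ((pois1 d).mul_left b)).add ((pois2 d).mul_left c)).mul_left
    (Real.exp (-d))
  have e : Real.exp (-d) * Real.exp d = 1 := by rw [← Real.exp_add]; simp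
  convert! h using 1
  · funext k; unfold poi; ring
  · linear_combination (-(a + b * d + c * d^2)) * e

lemma phi_bdd (v : ℝ) : phi v * (1 + v^6) ≤ 100 := by
  have h1 : phi v ≤ Real.exp (-(v^2)/2) := by
    unfold phi
    have : (Real.sqrt (2 * Real.pi))⁻¹ ≤ 1 := by
      apply inv_le_one_of_one_le₀
      rw [Real.one_le_sqrt]
      nlinarith [Real.pi_gt_three]
    nlinarith [Real.exp_pos (-(v^2)/2)]
  have h2 := Real.pow_div_factorial_le_exp (v^2/2) (by positivity) 3
  have h3 := Real.one_le_exp (x := v^2/2) (by positivity)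
  have e : Real.exp (-(v^2)/2) * Real.exp (v^2/2) = 1 := by rw [← Real.exp_add]; simp [neg_div]
  have h4 : 1 + v^6 ≤ 100 * Real.exp (v^2/2) := by
    simp [Nat.factorial] at h2
    nlinarith
  calc phi v * (1 + v^6) ≤ Real.exp (-(v^2)/2) * (100 * Real.exp (v^2/2)) := by gcongr
    _ = 100 := by linear_combination 100 * e

/-- pointwise sandwich -/
lemma sandwich (w s : ℕ → ℝ) (h : ℝ) (hw : ∀ k, 0 ≤ w k) (hP : 0 < ∑' k, w k)
    (hsw : Summable w) (hs2 : Summable fun k => w k * (s k)^2) :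
    Summable (fun k => w k * s k) ∧ Summable (fun k => w k * (s k - h)^2) ∧
    (∑' k, w k * s k)^2 / (∑' k, w k) ≤ ∑' k, w k * (s k)^2 ∧
    ∑' k, w k * (s k)^2 - ∑' k, w k * (s k - h)^2 ≤ (∑' k, w k * s k)^2 / (∑' k, w k) := by
  have hs1 : Summable (fun k => w k * s k) := by
    refine Summable.of_norm_bounded (hsw.add hs2) fun k => ?_
    rw [Real.norm_eq_abs, abs_mul, abs_of_nonneg (hw k)]
    nlinarith [hw k, sq_abs (s k), sq_nonneg (|s k| - 1), mul_nonneg (hw k) (sq_nonneg (|s k| - 1)), mul_nonneg (hw k) (abs_nonneg (s k))]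
  have key : ∀ c : ℝ, HasSum (fun k => w k * (s k - c)^2)
      (∑' k, w k * (s k)^2 - 2 * c * (∑' k, w k * s k) + c^2 * ∑' k, w k) := by
    intro c
    have := (hs2.hasSum.sub (hs1.hasSum.mul_left (2*c))).add (hsw.hasSum.mul_left (c^2))
    convert! this using 1
    funext k; ring
  refine ⟨hs1, (key h).summable, ?_, ?_⟩
  · set S := ∑' k, w k * s k
    set P := ∑' k, w k
    have h1 := (key (S/P)).nonneg fun k => mul_nonneg (hw k) (sq_nonneg _)
    have e : S/P * P = S := div_mul_cancel₀ _ hP.ne'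
    have e2 : S^2/P = S/P * S := by ring
    have e3 : (S/P)^2 * P = S/P * S := by rw [sq, mul_assoc, e]
    linarith
  · rw [(key h).tsum_eq]
    set S := ∑' k, w k * s k
    set P := ∑' k, w k
    have e : S^2/P - 2*h*S + h^2*P = (S - h*P)^2/P := by field_simp; ring
    have : 0 ≤ (S - h*P)^2/P := by positivity
    linarith

lemma mix (d L T : ℝ) (hd : 0 < d) (g : ℕ → ℝ → ℝ) (I : ℕ → ℝ) (hg : ∀ k v, 0 ≤ g k v)
    (hi : ∀ k, Integrable (g k)) (hI : ∀ k, ∫ v, g k v = I k)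
    (hT : HasSum (fun k => poi d k * I k) T) (hT0 : 0 < T) :
    Integrable (fun u => ∑' k : ℕ, poi d k * g k (u - k * L)) ∧
    ∫ u, ∑' k : ℕ, poi d k * g k (u - k * L) = T := by
  have h1 : ∀ k : ℕ, ∫ u, poi d k * g k (u - k * L) = poi d k * I k := by
    intro k
    rw [integral_const_mul, integral_sub_right_eq_self (g k), hI]
  have h2 := hasSum_integral_of_summable_integral_norm (μ := volume)
    (F := fun (k : ℕ) u => poi d k * g k (u - k * L))
    (fun k => ((hi k).comp_sub_right _).const_mul _) (by
      refine hT.summable.congr fun k => ?_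
      rw [← h1]
      refine integral_congr_ae (ae_of_all _ fun u => ?_)
      simp only
      rw [Real.norm_of_nonneg (mul_nonneg (poi_nonneg hd k) (hg k _))])
  simp only [h1] at h2
  have h3 := h2.unique hT
  refine ⟨?_, h3⟩
  by_contra hc
  rw [integral_undef hc] at h3
  linarith

noncomputable def hh (M u : ℝ) : ℝ :=
  if |u| ≤ M then u^2 - 1 else if |u - M^4| ≤ M then M^4 * (u - M^4) else 0

lemma hh_sq (M u : ℝ) (hM : 2 ≤ M) : (hh M u)^2 ≤ M^10 := by
  unfold hh
  split_ifs with h1 h2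
  · have h3 : u^2 ≤ M^2 := sq_le_sq' (by linarith [(abs_le.1 h1).1]) (abs_le.1 h1).2
    have h4 : (u^2-1)^2 ≤ (M^2)^2 := by
      apply sq_le_sq' <;> nlinarith [sq_nonneg u]
    have : M^4 ≤ M^10 := pow_le_pow_right₀ (by linarith) (by norm_num)
    nlinarith
  · have h3 : (u - M^4)^2 ≤ M^2 := sq_le_sq' (by linarith [(abs_le.1 h2).1]) (abs_le.1 h2).2
    calc (M^4 * (u - M^4))^2 = M^8 * (u - M^4)^2 := by ring
      _ ≤ M^8 * M^2 := by gcongr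
      _ = M^10 := by ring
  · rw [zero_pow two_ne_zero]; positivity

lemma polyA (v : ℝ) : (v^2-1)^2 ≤ 1 + v^6 := by
  have hx := sq_nonneg v
  have : 0 ≤ v^2 * ((v^2 - 1/2)^2 + 7/4) := by positivity
  nlinarith
lemma polyB (v : ℝ) : v^2 ≤ 1 + v^6 := by
  have : 0 ≤ v^2 * (v^2-1)^2 + (v^2 - 1)^2 + v^4 + 0 := by positivity
  nlinarith [sq_nonneg v, sq_nonneg (v^2-1), mul_nonneg (sq_nonneg v) (sq_nonneg (v^2-1))]
lemma polyC (v : ℝ) : v^4 ≤ 1 + v^6 := by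
  nlinarith [sq_nonneg v, sq_nonneg (v^2-1), mul_nonneg (sq_nonneg v) (sq_nonneg (v^2-1))]

lemma core0 (M u : ℝ) (hM : 2 ≤ M) :
    (u^2 - 1 - hh M u)^2 ≤ 18 * ((1 + u^6) * (M⁻¹^2)) := by
  by_cases h1 : |u| ≤ M
  · simp only [hh, h1, if_true, sub_self]; rw [zero_pow two_ne_zero]; positivity
  · have hu : M < |u| := not_le.1 h1
    have hu2 : M^2 ≤ u^2 := by rw [← sq_abs u]; gcongr
    have e : M⁻¹^2 = 1 / M^2 := by field_simp
    have hA : (u^2-1)^2 * M^2 ≤ u^6 := by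
      have : (u^2-1)^2 ≤ (u^2)^2 := by apply sq_le_sq' <;> nlinarith
      calc (u^2-1)^2 * M^2 ≤ (u^2)^2 * u^2 := by gcongr
        _ = u^6 := by ring
    have hB : (hh M u)^2 * M^2 ≤ u^6 := by
      by_cases h2 : |u - M^4| ≤ M
      · have h3 := hh_sq M u hM
        have h4 := (abs_le.1 h2).1
        have h5 : M^2 ≤ u := by
          have : M^2 * 4 ≤ M^2 * M^2 := by gcongr; nlinarith
          nlinarith
        calc (hh M u)^2 * M^2 ≤ M^10 * M^2 := by gcongr
          _ = (M^2)^6 := by ring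
          _ ≤ u^6 := by gcongr
      · simp only [hh, h1, h2, if_false]; simp; positivity
    rw [e, show 18 * ((1 + u^6) * (1/M^2)) = 18 * (1+u^6) / M^2 by ring, le_div_iff₀ (by positivity)]
    have h6 : (u^2 - 1 - hh M u)^2 ≤ 2 * (u^2-1)^2 + 2 * (hh M u)^2 := by
      nlinarith [sq_nonneg (u^2 - 1 + hh M u)]
    have h7 : 0 ≤ u^6 := by positivity
    calc (u^2 - 1 - hh M u)^2 * M^2 ≤ (2 * (u^2-1)^2 + 2 * (hh M u)^2) * M^2 := by gcongr
      _ ≤ 18 * (1 + u^6) := by nlinarith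

lemma core1 (M v : ℝ) (hM : 2 ≤ M) :
    (v^2 - 1 + M^4 * v - hh M (v + M^4))^2 ≤ 18 * ((1 + v^6) * M^6) := by
  have hM6 : 1 ≤ M^6 := one_le_pow₀ (by linarith)
  have hv6 : 0 ≤ v^6 := by positivity
  have hbig : 2 * M < M^4 := by
    have : M * 8 ≤ M * M^3 := by
      gcongr
      calc (8:ℝ) = 2^3 := by norm_num
        _ ≤ M^3 := by gcongr
    nlinarith
  by_cases h1 : |v| ≤ M
  · have h2 : ¬ |v + M^4| ≤ M := by
      rw [not_le]
      have := (abs_le.1 h1).1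
      exact lt_of_lt_of_le (by linarith) (le_abs_self _)
    simp only [hh, h2, if_false, add_sub_cancel_right, h1, if_true]
    have := polyA v
    nlinarith
  · have hu : M < |v| := not_le.1 h1
    have hu2 : M^2 ≤ v^2 := by rw [← sq_abs v]; gcongr
    have hH : (hh M (v+M^4))^2 ≤ M^6 := by
      by_cases h2 : |v + M^4| ≤ M
      · simp only [hh, h2, if_true]
        have h3 : (v+M^4)^2 ≤ M^2 := sq_le_sq' (by linarith [(abs_le.1 h2).1]) (abs_le.1 h2).2
        have h4 : ((v+M^4)^2-1)^2 ≤ (M^2)^2 := by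
          apply sq_le_sq' <;> nlinarith [sq_nonneg (v+M^4)]
        have : M^4 ≤ M^6 := pow_le_pow_right₀ (by linarith) (by norm_num)
        nlinarith
      · simp only [hh, h2, if_false, add_sub_cancel_right, h1]; simp; positivity
    have hV : (M^4*v)^2 ≤ (1+v^6) * M^6 := by
      calc (M^4*v)^2 = M^6 * (M^2 * v^2) := by ring
        _ ≤ M^6 * (v^2 * v^2) := by gcongr
        _ = v^4 * M^6 := by ring
        _ ≤ (1+v^6) * M^6 := by gcongr; exact polyC v
    have hA := polyA v
    have h3 : ∀ a b c : ℝ, (a + b - c)^2 ≤ 3 * a^2 + 3 * b^2 + 3 * c^2 := fun a b c => by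
      nlinarith [sq_nonneg (a - b), sq_nonneg (a + c), sq_nonneg (b + c)]
    have := h3 (v^2-1) (M^4*v) (hh M (v+M^4))
    nlinarith [mul_nonneg hv6 (by positivity : 0 ≤ M^6)]

lemma core2 (M v h k : ℝ) (hM : 2 ≤ M) (hk : 2 ≤ k) (hh : h^2 ≤ M^10) :
    (v^2 - 1 + k * M^4 * v - h)^2 ≤ 18 * ((1 + v^6) * (M^10 * (k * (k - 1)))) := by
  have hM10 : 1 ≤ M^10 := one_le_pow₀ (by linarith)
  have hv6 : 0 ≤ v^6 := by positivity
  have hA := polyA v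
  have h3 : ∀ a b c : ℝ, (a + b - c)^2 ≤ 3 * a^2 + 3 * b^2 + 3 * c^2 := fun a b c => by
    nlinarith [sq_nonneg (a - b), sq_nonneg (a + c), sq_nonneg (b + c)]
  have h4 := h3 (v^2-1) (k*M^4*v) h
  have hk2 : 1 ≤ k^2 := by nlinarith
  have hkk : k^2 ≤ 2 * (k * (k-1)) := by nlinarith
  have hMk : 1 ≤ M^10 * k^2 := one_le_mul_of_one_le_of_one_le hM10 hk2
  have b1 : (v^2-1)^2 ≤ (1+v^6) * (M^10 * k^2) := by nlinarith
  have b2 : (k*M^4*v)^2 ≤ (1+v^6) * (M^10 * k^2) := by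
    calc (k*M^4*v)^2 = v^2 * (M^8 * k^2) := by ring
      _ ≤ (1+v^6) * (M^10 * k^2) := by
        gcongr
        · exact polyB v
        · linarith
        · norm_num
  have b3 : h^2 ≤ (1+v^6) * (M^10 * k^2) := by
    calc h^2 ≤ 1 * (M^10 * 1) := by linarith
      _ ≤ _ := by gcongr; linarith
  calc (v^2 - 1 + k * M^4 * v - h)^2 ≤ 9 * ((1+v^6) * (M^10 * k^2)) := by linarith
    _ ≤ 9 * ((1+v^6) * (M^10 * (2 * (k * (k-1))))) := by gcongr
    _ = _ := by ring

lemma core (M u : ℝ) (k : ℕ) (hM : 2 ≤ M) :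
    ((u - k * M^4)^2 - 1 + k * M^4 * (u - k * M^4) - hh M u)^2 ≤
      18 * ((1 + (u - k * M^4)^6) * (M⁻¹^2 + M^6 * k + M^10 * (k * (k - 1)))) := by
  match k with
  | 0 => simpa using core0 M u hM
  | 1 =>
    have := core1 M (u - M^4) hM
    simp only [sub_add_cancel] at this
    simp only [Nat.cast_one, one_mul, sub_self, mul_zero, add_zero, mul_one]
    refine this.trans ?_
    have : 0 ≤ M⁻¹^2 := by positivity
    gcongr
    linarith
  | (n+2) =>
    have hk : (2:ℝ) ≤ ((n+2:ℕ):ℝ) := by push_cast; linarith [(Nat.cast_nonneg n : (0:ℝ) ≤ n)]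
    refine (core2 M (u - ((n+2:ℕ):ℝ) * M^4) (hh M u) _ hM hk (hh_sq M u hM)).trans ?_
    gcongr
    have : 0 ≤ M⁻¹^2 := by positivity
    have : 0 ≤ M^6 * ((n+2:ℕ):ℝ) := by positivity
    linarith

lemma meas_tsum (F : ℕ → ℝ → ℝ) (hF : ∀ k, Measurable (F k)) (hs : ∀ u, Summable fun k => F k u) :
    Measurable (fun u => ∑' k, F k u) := by
  refine measurable_of_tendsto_metrizable (f := fun (n : ℕ) u => ∑ k ∈ Finset.range n, F k u) ?_ ?_
  · intro n; exact Finset.measurable_fun_sum _ fun k _ => hF k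
  · rw [tendsto_pi_nhds]; intro u; exact (hs u).hasSum.tendsto_sum_nat

noncomputable def JJ (M : ℝ) : ℝ := ∫ u,
  (∑' k : ℕ, (poi (M⁻¹^8) k * phi (u - k * M^4)) *
    ((u - k * M^4)^2 - 1 + k * M^4 * (u - k * M^4)))^2 /
  (∑' k : ℕ, poi (M⁻¹^8) k * phi (u - k * M^4))

lemma phi_meas : Measurable phi := by unfold phi; fun_prop

lemma JJ_bound (M : ℝ) (hM : 2 ≤ M) :
    |JJ M - 3| ≤ M⁻¹^8 + 18 * (∫ v, phi v * (1 + v^6)) * (3 * M⁻¹^2) := by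
  have hM0 : 0 < M := by linarith
  have hMi : 0 < M⁻¹ := by positivity
  set d := M⁻¹^8 with hd
  have hd0 : 0 < d := by positivity
  set K := ∫ v, phi v * (1 + v^6) with hK
  have hKi : Integrable (fun v => phi v * (1 + v^6)) := by
    refine ((phi_int_pow 0).add (phi_int_pow 6)).congr (ae_of_all _ fun v => ?_)
    simp only [Pi.add_apply]; ring
  have hK1 : 1 ≤ K := by
    rw [← phi_integral]
    refine integral_mono (by simpa using phi_int_pow 0) hKi fun v => ?_
    have := phi_pos v
    have : 0 ≤ v^6 := by positivity
    simp only
    nlinarith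
  have hMM : M * M⁻¹ = 1 := mul_inv_cancel₀ hM0.ne'
  have hc0 : ∀ k : ℕ, 0 ≤ (M⁻¹^2 + M^6 * k + M^10 * (k * (k - 1)) : ℝ) := by
    intro k
    have : (0:ℝ) ≤ k * (k-1) := by
      rcases Nat.eq_zero_or_pos k with h | h
      · simp [h]
      · have : (1:ℝ) ≤ k := by exact_mod_cast h
        nlinarith
    positivity
  -- the majorant
  obtain ⟨hBi, hB⟩ := mix d (M^4) (18 * K * (M⁻¹^2 + M^6 * d + M^10 * d^2)) hd0
    (fun k v => 18 * (M⁻¹^2 + M^6 * k + M^10 * (k * (k - 1))) * (phi v * (1 + v^6)))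
    (fun k => 18 * (M⁻¹^2 + M^6 * k + M^10 * (k * (k - 1))) * K)
    (fun k v => by have := hc0 k; have := phi_pos v; positivity)
    (fun k => hKi.const_mul _)
    (fun k => by rw [integral_const_mul])
    (by
      convert! (poi_sum d (M⁻¹^2) (M^6) (M^10)).mul_left (18 * K) using 2
      ring)
    (by positivity)
  -- the full information
  obtain ⟨hGi, hG⟩ := mix d (M^4) (3 + d) hd0
    (fun k v => phi v * (v^2 - 1 + k * M^4 * v)^2)
    (fun k => 2 + (k * M^4)^2)
    (fun k v => by have := phi_pos v; positivity)
    (fun k => phi_int_quad _)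
    (fun k => phi_integral_quad _)
    (by
      have e : M^8 * d = 1 := by rw [hd, ← mul_pow, hMM, one_pow]
      convert! poi_sum d 2 (M^8) (M^8) using 2
      · ring
      · linear_combination (-1) * e
      · linear_combination (-d) * e)
    (by positivity)
  -- pointwise summability
  have hw0 : ∀ u : ℝ, ∀ k : ℕ, 0 ≤ poi d k * phi (u - k * M^4) := fun u k =>
    mul_nonneg (poi_nonneg hd0 k) (phi_pos _).le
  have hphi : ∀ v, phi v ≤ 100 := fun v => by
    have := phi_bdd v
    have := phi_pos v
    have : 0 ≤ v^6 := by positivity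
    nlinarith
  have hsw : ∀ u : ℝ, Summable fun k : ℕ => poi d k * phi (u - k * M^4) := fun u => by
    refine Summable.of_nonneg_of_le (hw0 u) (fun k => ?_) (poi_sum d 100 0 0).summable
    have := hphi (u - k * M^4)
    have := poi_nonneg hd0 k
    simp only [zero_mul, add_zero]
    gcongr
  have hP : ∀ u : ℝ, 0 < ∑' k : ℕ, poi d k * phi (u - k * M^4) := fun u => by
    refine (hsw u).tsum_pos (hw0 u) 0 ?_
    have : 0 < poi d 0 := by unfold poi; positivity
    exact mul_pos this (phi_pos _)
  have hs2 : ∀ u : ℝ, Summable fun k : ℕ => (poi d k * phi (u - k * M^4)) *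
      ((u - k * M^4)^2 - 1 + k * M^4 * (u - k * M^4))^2 := fun u => by
    refine Summable.of_nonneg_of_le (fun k => mul_nonneg (hw0 u k) (sq_nonneg _)) (fun k => ?_)
      (poi_sum d 200 (200 * M^8) (200 * M^8)).summable
    set v := u - k * M^4
    have h1 : (v^2 - 1 + k * M^4 * v)^2 ≤ 2 * ((1+v^6) * (1 + M^8 * k^2)) := by
      have hA := polyA v
      have hB : (k * M^4 * v)^2 ≤ (1+v^6) * (M^8 * k^2) := by
        calc (k * M^4 * v)^2 = v^2 * (M^8 * k^2) := by ring
          _ ≤ _ := by gcongr; exact polyB v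
      nlinarith [sq_nonneg (v^2 - 1 - k * M^4 * v)]
    have h2 := phi_bdd v
    have h3 := phi_pos v
    have h4 := poi_nonneg hd0 k
    calc poi d k * phi v * (v^2 - 1 + k * M^4 * v)^2
        ≤ poi d k * phi v * (2 * ((1+v^6) * (1 + M^8 * k^2))) := by gcongr
      _ = poi d k * ((phi v * (1+v^6)) * (2 * (1 + M^8 * k^2))) := by ring
      _ ≤ poi d k * (100 * (2 * (1 + M^8 * k^2))) := by gcongr
      _ = _ := by ring
  have hsB : ∀ u : ℝ, Summable fun k : ℕ => poi d k *
      (18 * (M⁻¹^2 + M^6 * k + M^10 * (k * (k - 1))) * (phi (u - k * M^4) * (1 + (u - k * M^4)^6))) :=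
    fun u => by
    refine Summable.of_nonneg_of_le (fun k => ?_) (fun k => ?_)
      ((poi_sum d (M⁻¹^2) (M^6) (M^10)).mul_left 1800).summable
    · have := hc0 k; have := phi_pos (u - k * M^4); have := poi_nonneg hd0 k; positivity
    · have h1 := hc0 k
      have h2 := phi_bdd (u - k * M^4)
      have h4 := poi_nonneg hd0 k
      calc _ ≤ poi d k * (18 * (M⁻¹^2 + M^6 * k + M^10 * (k * (k - 1))) * 100) := by gcongr
        _ = _ := by ring
  have main := fun u => sandwich (fun k : ℕ => poi d k * phi (u - k * M^4))
    (fun k : ℕ => (u - k * M^4)^2 - 1 + k * M^4 * (u - k * M^4)) (hh M u) (hw0 u) (hP u) (hsw u) (hs2 u)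
  have hR : ∀ u : ℝ, ∑' k : ℕ, (poi d k * phi (u - k * M^4)) *
      ((u - k * M^4)^2 - 1 + k * M^4 * (u - k * M^4) - hh M u)^2 ≤ ∑' k : ℕ, poi d k *
      (18 * (M⁻¹^2 + M^6 * k + M^10 * (k * (k - 1))) * (phi (u - k * M^4) * (1 + (u - k * M^4)^6))) := by
    intro u
    refine (main u).2.1.tsum_le_tsum (fun k => ?_) (hsB u)
    have := core M u k hM
    have h0 := hw0 u k
    calc _ ≤ poi d k * phi (u - k * M^4) * (18 * ((1 + (u - k * M^4)^6) * (M⁻¹^2 + M^6 * k + M^10 * (k * (k - 1))))) := by gcongr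
      _ = _ := by ring
  simp only [← mul_assoc (poi d _) (phi _) (_ ^ 2)] at hGi hG
  have hmeas : Measurable (fun u : ℝ => (∑' k : ℕ, (poi d k * phi (u - k * M^4)) *
      ((u - k * M^4)^2 - 1 + k * M^4 * (u - k * M^4)))^2 /
      (∑' k : ℕ, poi d k * phi (u - k * M^4))) := by
    have := phi_meas
    refine Measurable.div (Measurable.pow_const (meas_tsum _ (fun k => ?_) fun u => (main u).1) 2)
      (meas_tsum _ (fun k => ?_) hsw)
    · fun_prop
    · fun_prop
  have hfi : Integrable (fun u : ℝ => (∑' k : ℕ, (poi d k * phi (u - k * M^4)) *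
      ((u - k * M^4)^2 - 1 + k * M^4 * (u - k * M^4)))^2 /
      (∑' k : ℕ, poi d k * phi (u - k * M^4))) := by
    refine hGi.mono' hmeas.aestronglyMeasurable (ae_of_all _ fun u => ?_)
    have := hP u
    rw [Real.norm_of_nonneg (by positivity)]
    exact (main u).2.2.1
  have up : JJ M ≤ 3 + d := by
    rw [← hG]
    exact integral_mono hfi hGi fun u => (main u).2.2.1
  have lo : (3 + d) - 18 * K * (M⁻¹^2 + M^6 * d + M^10 * d^2) ≤ JJ M := by
    rw [← hG, ← hB, ← integral_sub hGi hBi]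
    refine integral_mono (hGi.sub hBi) hfi fun u => ?_
    have h1 := (main u).2.2.2
    have h2 := hR u
    simp only
    linarith
  have e1 : M^6 * d = M⁻¹^2 := by
    rw [hd]; field_simp
  have e2 : M^10 * d^2 ≤ M⁻¹^2 := by
    have : M^10 * d^2 = M⁻¹^6 := by rw [hd]; field_simp
    rw [this]
    exact pow_le_pow_of_le_one hMi.le (inv_le_one_of_one_le₀ (by linarith)) (by norm_num)
  have e3 : 18 * K * (M⁻¹^2 + M^6 * d + M^10 * d^2) ≤ 18 * K * (3 * M⁻¹^2) := by
    gcongr; linarith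
  have e4 : 0 ≤ 18 * K * (3 * M⁻¹^2) := by positivity
  rw [abs_le]
  constructor <;> linarith

lemma JJ_tendsto : Tendsto JJ atTop (𝓝 3) := by
  rw [tendsto_iff_norm_sub_tendsto_zero]
  have hz : Tendsto (fun M : ℝ => M⁻¹^8 + 18 * (∫ v, phi v * (1 + v^6)) * (3 * M⁻¹^2)) atTop (𝓝 0) := by
    have h := tendsto_inv_atTop_zero (𝕜 := ℝ)
    have := (h.pow 8).add (((h.pow 2).const_mul 3).const_mul (18 * (∫ v, phi v * (1 + v^6))))
    simpa using this
  refine squeeze_zero' (Eventually.of_forall fun M => norm_nonneg _) ?_ hz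
  filter_upwards [eventually_ge_atTop 2] with M hM
  exact JJ_bound M hM

lemma reduce (σ M : ℝ) (hσ : 0 < σ) (hM : 0 < M) (Δ : ℝ) (hΔ : Δ = M⁻¹^8) :
    (∫ x : ℝ,
          (Real.exp (-Δ) * ∑' k : ℕ, (Δ ^ k / (k.factorial : ℝ)) *
              (gauss (σ ^ 2 * Δ) (x - σ * k) *
                ((x - σ * k) ^ 2 / (σ ^ 3 * Δ) + (k : ℝ) * (x - σ * k) / (σ ^ 2 * Δ) - 1 / σ))) ^ 2 /
          (Real.exp (-Δ) * ∑' k : ℕ, (Δ ^ k / (k.factorial : ℝ)) *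
              gauss (σ ^ 2 * Δ) (x - σ * k))) = JJ M / σ^2 := by
  set a := σ * M⁻¹^4 with ha
  have ha0 : 0 < a := by positivity
  have hg : ∀ v, gauss (σ^2 * Δ) (a * v) = a⁻¹ * phi v := by
    intro v
    have e : σ^2 * Δ = a^2 := by rw [hΔ, ha]; ring
    rw [e]
    unfold gauss phi
    rw [Real.sqrt_mul (by positivity), Real.sqrt_sq ha0.le, mul_inv]
    rw [show -((a*v)^2) / (2 * a^2) = -(v^2)/2 by field_simp]
    ring
  have hx : ∀ (u : ℝ) (k : ℕ), a * u - σ * k = a * (u - k * M^4) := by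
    intro u k; rw [ha]; field_simp
  have h := Measure.integral_comp_mul_left (fun x : ℝ =>
          (Real.exp (-Δ) * ∑' k : ℕ, (Δ ^ k / (k.factorial : ℝ)) *
              (gauss (σ ^ 2 * Δ) (x - σ * k) *
                ((x - σ * k) ^ 2 / (σ ^ 3 * Δ) + (k : ℝ) * (x - σ * k) / (σ ^ 2 * Δ) - 1 / σ))) ^ 2 /
          (Real.exp (-Δ) * ∑' k : ℕ, (Δ ^ k / (k.factorial : ℝ)) *
              gauss (σ ^ 2 * Δ) (x - σ * k))) a
  rw [abs_of_pos (by positivity), smul_eq_mul, eq_comm, inv_mul_eq_iff_eq_mul₀ ha0.ne'] at h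
  rw [h, JJ, ← integral_const_mul, ← integral_div]
  refine integral_congr_ae (ae_of_all _ fun u => ?_)
  simp only [hx, hg]
  rw [← hΔ]
  have e1 : Real.exp (-Δ) * ∑' k : ℕ, (Δ ^ k / (k.factorial : ℝ)) * (a⁻¹ * phi (u - k * M^4)) =
      a⁻¹ * ∑' k : ℕ, poi Δ k * phi (u - k * M^4) := by
    rw [← tsum_mul_left, ← tsum_mul_left]
    refine tsum_congr fun k => ?_
    unfold poi; ring
  have e2 : Real.exp (-Δ) * ∑' k : ℕ, (Δ ^ k / (k.factorial : ℝ)) * (a⁻¹ * phi (u - k * M^4) *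
        ((a * (u - k * M^4)) ^ 2 / (σ ^ 3 * Δ) + (k : ℝ) * (a * (u - k * M^4)) / (σ ^ 2 * Δ) - 1 / σ)) =
      a⁻¹ * σ⁻¹ * ∑' k : ℕ, (poi Δ k * phi (u - k * M^4)) *
        ((u - k * M^4)^2 - 1 + k * M^4 * (u - k * M^4)) := by
    rw [← tsum_mul_left, ← tsum_mul_left]
    refine tsum_congr fun k => ?_
    set v := u - k * M^4
    have : (a * v) ^ 2 / (σ ^ 3 * Δ) + (k : ℝ) * (a * v) / (σ ^ 2 * Δ) - 1 / σ =
        σ⁻¹ * (v^2 - 1 + k * M^4 * v) := by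
      rw [hΔ, ha]; field_simp; ring
    rw [this]; unfold poi; ring
  rw [e1, e2]
  generalize (∑' k : ℕ, (poi Δ k * phi (u - k * M^4)) *
        ((u - k * M^4)^2 - 1 + k * M^4 * (u - k * M^4))) = S
  generalize (∑' k : ℕ, poi Δ k * phi (u - k * M^4)) = P
  field_simp

/-- Theorem 6.2, case β = 2 (multiplicative model X = σ(W + N)): the Fisher information
for σ converges to 3/σ² as Δ → 0. -/
theorem stmt_18 (σ : ℝ) (hσ : 0 < σ) :
    Tendsto (fun Δ : ℝ =>
        ∫ x : ℝ,
          (Real.exp (-Δ) * ∑' k : ℕ, (Δ ^ k / (k.factorial : ℝ)) *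
              (gauss (σ ^ 2 * Δ) (x - σ * k) *
                ((x - σ * k) ^ 2 / (σ ^ 3 * Δ) + (k : ℝ) * (x - σ * k) / (σ ^ 2 * Δ) - 1 / σ))) ^ 2 /
          (Real.exp (-Δ) * ∑' k : ℕ, (Δ ^ k / (k.factorial : ℝ)) *
              gauss (σ ^ 2 * Δ) (x - σ * k)))
      (𝓝[>] 0) (𝓝 (3 / σ ^ 2)) := by
  have h1 : Tendsto (fun Δ : ℝ => (Δ⁻¹) ^ ((1:ℝ)/8)) (𝓝[>] 0) atTop :=
    (tendsto_rpow_atTop (by norm_num : (0:ℝ) < 1/8)).comp tendsto_inv_nhdsGT_zero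
  refine ((JJ_tendsto.comp h1).div_const (σ^2)).congr' ?_
  filter_upwards [self_mem_nhdsWithin] with Δ hΔ
  have hΔ0 : (0:ℝ) < Δ := hΔ
  refine (reduce σ _ hσ (by positivity) Δ ?_).symm
  rw [inv_pow, ← Real.rpow_natCast, ← Real.rpow_mul (by positivity)]
  norm_num
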